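/- Let G be a finite simple claw-free graph of order 2n that is k-extendable for an integer k with 1 ≤ k ≤ n−1. Then δ(G) ≥ 2k. -/

import Mathlib

open SimpleGraph

/-- A graph `G` is `k`-extendable if it is connected, has a perfect matching, and every
matching of size `k` is contained in a perfect matching. -/
def KExt {V : Type*} [Fintype V] (G : SimpleGraph V) (k : ℕ) : Prop :=
  G.Connected ∧ (∃ P : G.Subgraph, P.IsPerfectMatching) ∧
    ∀ M : G.Subgraph, M.IsMatching → M.edgeSet.ncard = k →
      ∃ P : G.Subgraph, P.IsPerfectMatching ∧ M ≤ P

/-- A graph is claw-free if it has no induced subgraph isomorphic to `K_{1,3}`. -/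
def ClawFree {V : Type*} (G : SimpleGraph V) : Prop :=
  ∀ u a b c : V, G.Adj u a → G.Adj u b → G.Adj u c →
    a ≠ b → a ≠ c → b ≠ c → ¬G.Adj a b → ¬G.Adj a c → ¬G.Adj b c → False

/-- `Matchable G S` says that `S` is the vertex set of some matching of `G`. -/
inductive Matchable {V : Type*} [DecidableEq V] (G : SimpleGraph V) : Finset V → Prop
  | empty : Matchable G ∅
  | insert_pair {x y : V} {S : Finset V} (h : G.Adj x y) (hx : x ∉ S) (hy : y ∉ S)
      (hS : Matchable G S) : Matchable G (insert x (insert y S))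

/-- `k`-extendability of the subgraph induced on `S`, phrased with vertex sets of matchings. -/
structure ExtOn {V : Type*} [DecidableEq V] (G : SimpleGraph V) (S : Finset V) (k : ℕ) :
    Prop where
  conn : ∀ A ⊆ S, A.Nonempty → (S \ A).Nonempty → ∃ a ∈ A, ∃ b ∈ S \ A, G.Adj a b
  ext : ∀ T ⊆ S, Matchable G T → T.card = 2 * k → Matchable G (S \ T)
  matchable : Matchable G S

section Matchable

variable {V : Type*} [DecidableEq V] {G : SimpleGraph V} {S T : Finset V}

lemma card_sdiff_lt_of_mem {R : Finset V} {u : V} (hS : u ∈ S) (hR : u ∈ R) :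
    (S \ R).card < S.card :=
  Finset.card_lt_card <| (Finset.ssubset_iff_of_subset Finset.sdiff_subset).2
    ⟨u, hS, by simp [hR]⟩

lemma Matchable.even_card (h : Matchable G S) : Even S.card := by
  induction h with
  | empty => simp
  | insert_pair h hx hy _ ih =>
    rw [Finset.card_insert_of_notMem (by simp [h.ne, hx]), Finset.card_insert_of_notMem hy]
    grind

lemma Matchable.exists_partner (h : Matchable G S) {w : V} (hw : w ∈ S) :
    ∃ z ∈ S, G.Adj w z ∧ Matchable G (S \ {w, z}) := by
  induction h with
  | empty => simp at hw
  | @insert_pair x y S h hx hy hS ih =>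
    by_cases hwx : w = x
    · subst hwx
      refine ⟨y, by simp, h, ?_⟩
      convert hS using 1
      grind
    by_cases hwy : w = y
    · subst hwy
      refine ⟨x, by simp, h.symm, ?_⟩
      convert hS using 1
      grind
    obtain ⟨z, hz, hwz, hm⟩ := ih (by grind)
    refine ⟨z, by grind, hwz, ?_⟩
    convert Matchable.insert_pair h (S := S \ {w, z}) (by grind) (by grind) hm using 1
    grind

lemma Matchable.of_sdiff_pair {x y : V} (h : G.Adj x y) (hx : x ∈ S) (hy : y ∈ S)
    (hS : Matchable G (S \ {x, y})) : Matchable G S := by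
  convert Matchable.insert_pair h (S := S \ {x, y}) (by grind) (by grind) hS using 1
  grind

lemma Matchable.pair {x y : V} (h : G.Adj x y) : Matchable G {x, y} := by
  simpa using Matchable.insert_pair h (by simp) (by simp) Matchable.empty

/-- A matched vertex set inside a larger one can be augmented by any prescribed vertex. -/
lemma Matchable.augment (hS : Matchable G S) (hT : Matchable G T) (hTS : T ⊆ S) {u : V}
    (hu : u ∈ S) (huT : u ∉ T) :
    ∃ t ∈ S, t ∉ T ∧ t ≠ u ∧ Matchable G (insert u (insert t T)) := by
  induction hn : S.card using Nat.strong_induction_on generalizing S T u with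
  | _ n ih =>
    obtain ⟨w, hw, huw, hS'⟩ := hS.exists_partner hu
    by_cases hwT : w ∈ T
    · obtain ⟨z, hz, hwz, hT'⟩ := hT.exists_partner hwT
      have hlt : (S \ {u, w}).card < n :=
        hn ▸ card_sdiff_lt_of_mem hu (by simp)
      have huz : u ≠ z := by
        rintro rfl
        exact huT hz
      have hsub : T \ {w, z} ⊆ S \ {u, w} := by
        clear ih
        grind
      have hzS : z ∈ S \ {u, w} := by
        have := hwz.ne'
        have := hTS hz
        clear ih
        grind
      obtain ⟨t, ht, htT, htz, hm⟩ := ih _ hlt hS' hT' hsub hzS (by simp) rfl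
      have hwz' := hwz.ne
      clear ih
      refine ⟨t, by grind, by grind, by grind, ?_⟩
      convert Matchable.insert_pair huw (by grind) (by grind) hm using 1
      grind
    · exact ⟨w, hw, hwT, huw.ne', .insert_pair huw huT hwT hT⟩

lemma Matchable.inter (hS : Matchable G S) (A : Finset V)
    (hA : ∀ a ∈ S, a ∈ A → ∀ b ∈ S, b ∉ A → ¬ G.Adj a b) : Matchable G (S ∩ A) := by
  induction hS with
  | empty => simpa using Matchable.empty
  | @insert_pair x y S h hx hy hS ih =>
    have ih' := ih (by grind)
    by_cases hxA : x ∈ A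
    · have hyA : y ∈ A := by
        by_contra hyA
        exact hA x (by simp) hxA y (by simp) hyA h
      convert Matchable.insert_pair h (by grind) (by grind) ih' using 1
      grind
    · have hyA : y ∉ A := fun hyA ↦ hA y (by simp) hyA x (by simp) hxA h.symm
      convert ih' using 1
      grind

end Matchable

namespace ExtOn

variable {V : Type*} [DecidableEq V] {G : SimpleGraph V} {S : Finset V} {k : ℕ}

lemma of_succ (h : ExtOn G S (k + 1)) (hk : 2 * (k + 1) + 2 ≤ S.card) : ExtOn G S k := by
  refine ⟨h.conn, fun T hTS hT hc ↦ ?_, h.matchable⟩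
  by_cases he : ∃ x ∈ S \ T, ∃ y ∈ S \ T, G.Adj x y
  · obtain ⟨x, hx, y, hy, hxy⟩ := he
    have := h.ext (insert x (insert y T)) (by grind)
      (.insert_pair hxy (by grind) (by grind) hT) (by
        rw [Finset.card_insert_of_notMem (by grind [hxy.ne]),
          Finset.card_insert_of_notMem (by grind)]
        lia)
    refine .of_sdiff_pair hxy hx hy ?_
    convert this using 1
    grind
  · exfalso
    obtain ⟨u, hu, huT⟩ := Finset.exists_mem_notMem_of_card_lt_card (s := T) (t := S) (by lia)
    obtain ⟨t, ht, htT, htu, hm⟩ := h.matchable.augment hT hTS hu huT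
    have hc' : (insert u (insert t T)).card = 2 * (k + 1) := by
      rw [Finset.card_insert_of_notMem (by grind), Finset.card_insert_of_notMem htT]
      lia
    have hm' := h.ext _ (by grind) hm hc'
    obtain ⟨a, ha, haT⟩ :=
      Finset.exists_mem_notMem_of_card_lt_card (s := insert u (insert t T)) (t := S) (by lia)
    obtain ⟨b, hb, hab, -⟩ := hm'.exists_partner (w := a) (by grind)
    exact he ⟨a, by grind, b, by grind, hab⟩

lemma of_le (h : ExtOn G S k) (hk : 2 * k + 2 ≤ S.card) {j : ℕ} (hj : j ≤ k) :
    ExtOn G S j := by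
  induction k with
  | zero => simpa [Nat.le_zero.1 hj] using h
  | succ k ih =>
    rcases hj.eq_or_lt with rfl | hlt
    · exact h
    · exact ih (h.of_succ hk) (by lia) (by lia)

lemma matchable_sdiff_pair (h : ExtOn G S 1) {x y : V} (hx : x ∈ S) (hy : y ∈ S)
    (hxy : G.Adj x y) : Matchable G (S \ {x, y}) :=
  h.ext _ (by grind) (.pair hxy) (by simp [Finset.card_pair hxy.ne])

lemma exists_adj_ne (h : ExtOn G S 1) {x y z : V} (hx : x ∈ S) (hy : y ∈ S)
    (hz : z ∈ S) (hxy : G.Adj x y) (hzx : z ≠ x) (hzy : z ≠ y) :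
    ∃ w ∈ S, G.Adj z w ∧ w ≠ x ∧ w ≠ y := by
  obtain ⟨w, hw, hzw, -⟩ := (h.matchable_sdiff_pair hx hy hxy).exists_partner
    (w := z) (by grind)
  exact ⟨w, by grind, hzw, by grind, by grind⟩

/-- Every vertex is the end of a path on three vertices. -/
lemma exists_adj_adj (h : ExtOn G S 1) (hc : 4 ≤ S.card) {v : V} (hv : v ∈ S) :
    ∃ a ∈ S, ∃ x ∈ S, G.Adj v a ∧ G.Adj a x ∧ x ≠ v := by
  obtain ⟨a, ha, hva, -⟩ := h.matchable.exists_partner hv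
  have hne : (S \ {v, a}).Nonempty := by
    rw [← Finset.card_pos]
    have := Finset.le_card_sdiff {v, a} S
    rw [Finset.card_pair hva.ne] at this
    lia
  obtain ⟨b, hb, x, hx, hbx⟩ := h.conn {v, a} (by grind) (by simp) hne
  obtain rfl | rfl : b = v ∨ b = a := by simpa using hb
  · obtain ⟨w, hw, haw, hwx, hwb⟩ :=
      h.exists_adj_ne (z := a) (by grind : x ∈ S) hv ha hbx.symm (by grind) hva.ne'
    exact ⟨a, ha, w, hw, hva, haw, hwb⟩
  · exact ⟨b, ha, x, by grind, hva, hbx, by grind⟩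

/-- Two disjoint edges cannot send odd parts to two sides of a separation. -/
lemma not_cross (h : ExtOn G S 2) {x y a b : V} {A : Finset V} (hx : x ∈ S) (hy : y ∈ S)
    (hb : b ∈ S) (hAS : A ⊆ S) (hxA : x ∉ A) (hyA : y ∉ A) (ha : a ∈ A) (hbA : b ∉ A)
    (hxy : x ≠ y) (hbx : b ≠ x) (hxa : G.Adj x a) (hyb : G.Adj y b) (hA : Even A.card)
    (hsep : ∀ p ∈ A, ∀ q ∈ S \ {x, y}, q ∉ A → ¬ G.Adj p q) : False := by
  have hm : Matchable G (insert x (insert a {y, b})) :=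
    .insert_pair hxa (by grind) (by grind) (.pair hyb)
  have hc : (insert x (insert a {y, b}) : Finset V).card = 2 * 2 := by
    rw [Finset.card_insert_of_notMem (by grind [hxa.ne]),
      Finset.card_insert_of_notMem (by grind), Finset.card_pair hyb.ne]
  have hA' := ((h.ext _ (by grind) hm hc).inter A (by grind)).even_card
  have : (S \ insert x (insert a {y, b})) ∩ A = A.erase a := by grind
  rw [this, Finset.card_erase_of_mem ha] at hA'
  have := Finset.card_pos.2 ⟨a, ha⟩
  grind

lemma sdiff_pair (h : ExtOn G S (k + 1)) (hk : 1 ≤ k) (hc : 2 * (k + 1) + 2 ≤ S.card)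
    {x y : V} (hx : x ∈ S) (hy : y ∈ S) (hxy : G.Adj x y) : ExtOn G (S \ {x, y}) k := by
  have h1 := h.of_le hc (j := 1) (by lia)
  have h2 := h.of_le hc (j := 2) (by lia)
  have hm := h1.matchable_sdiff_pair hx hy hxy
  refine ⟨fun A hA hAne hBne ↦ ?_, fun T hTS hT hTc ↦ ?_, hm⟩
  · by_contra hno
    push Not at hno
    have hsep : ∀ p ∈ A, ∀ q ∈ S \ {x, y}, q ∉ A → ¬ G.Adj p q := by grind
    have hxA : x ∉ A := fun hxA ↦ by simpa using hA hxA
    have hyA : y ∉ A := fun hyA ↦ by simpa using hA hyA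
    have hAe : Even A.card := by
      have := (hm.inter A (by grind)).even_card
      rwa [Finset.inter_eq_right.2 hA] at this
    obtain ⟨a, ha, p, hp, hap⟩ := h.conn A (by grind) hAne (by grind)
    obtain ⟨b, hb, q, hq, hbq⟩ := h.conn ((S \ {x, y}) \ A) (by grind) hBne (by
      obtain ⟨a, ha⟩ := hAne
      exact ⟨a, by grind⟩)
    have hp' : p = x ∨ p = y := by
      by_contra hne
      exact hsep a ha p (by grind) (by grind) hap
    have hq' : q = x ∨ q = y := by
      by_contra hne
      exact hsep q (by grind) b (by grind) (by grind) hbq.symm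
    have hcross (x' y' : V) (hs : x' = x ∧ y' = y ∨ x' = y ∧ y' = x) (a' b' : V) (ha' : a' ∈ A)
        (hb' : b' ∈ (S \ {x, y}) \ A) (h₁ : G.Adj x' a') (h₂ : G.Adj y' b') : False := by
      have := hxy.ne
      exact h2.not_cross (x := x') (y := y') (a := a') (b := b') (A := A) (by grind)
        (by grind) (by grind) (by grind) (by grind) (by grind) ha' (by grind) (by grind)
        (by grind) h₁ h₂ hAe (by grind)
    have hsame (x' y' : V) (hs : x' = x ∧ y' = y ∨ x' = y ∧ y' = x) (h₁ : G.Adj a x')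
        (h₂ : G.Adj b x') : False := by
      have hy'x' : y' ≠ x' := by
        have := hxy.ne
        grind
      obtain ⟨w, hw, hyw, hwa, hwx⟩ := h1.exists_adj_ne (x := a) (y := x') (z := y')
        (by grind) (by grind) (by grind) h₁ (by grind) hy'x'
      have hwy := hyw.ne
      by_cases hwA : w ∈ A
      · exact hcross y' x' (by grind) w b hwA (by grind) hyw h₂.symm
      · exact hcross x' y' hs a w ha (by simp; grind) h₁.symm hyw
    rcases hp' with rfl | rfl <;> rcases hq' with rfl | rfl
    · exact hsame _ _ (.inl ⟨rfl, rfl⟩) hap hbq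
    · exact hcross _ _ (.inl ⟨rfl, rfl⟩) a b ha (by grind) hap.symm hbq.symm
    · exact hcross _ _ (.inr ⟨rfl, rfl⟩) a b ha (by grind) hap.symm hbq.symm
    · exact hsame _ _ (.inr ⟨rfl, rfl⟩) hap hbq
  · have := h.ext (insert x (insert y T)) (by grind)
      (.insert_pair hxy (by grind) (by grind) hT) (by
        rw [Finset.card_insert_of_notMem (by grind [hxy.ne]),
          Finset.card_insert_of_notMem (by grind)]
        lia)
    convert this using 1
    grind

open Classical in
lemma two_mul_le_card_neighbors (hclaw : ∀ u a b c : V, G.Adj u a → G.Adj u b → G.Adj u c →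
      a ≠ b → a ≠ c → b ≠ c → ¬G.Adj a b → ¬G.Adj a c → ¬G.Adj b c → False)
    (hk : 1 ≤ k) (h : ExtOn G S k) (hc : 2 * k + 2 ≤ S.card) {v : V} (hv : v ∈ S) :
    2 * k ≤ (S.filter (G.Adj v)).card := by
  induction k, hk using Nat.le_induction generalizing S with
  | base =>
    obtain ⟨a, ha, x, hx, hva, hax, hxv⟩ := h.exists_adj_adj hc hv
    obtain ⟨w, hw, hvw, hwa, -⟩ := h.exists_adj_ne ha hx hv hax hva.ne hxv.symm
    rw [mul_one, ← Finset.card_pair hwa]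
    exact Finset.card_le_card (by grind)
  | succ k hk ih =>
    have key {x y : V} (hx : x ∈ S) (hy : y ∈ S) (hxy : G.Adj x y) (hxv : x ≠ v)
        (hyv : y ≠ v) : 2 * k ≤ ((S \ {x, y}).filter (G.Adj v)).card := by
      refine ih (h.sdiff_pair hk hc hx hy hxy) ?_ (by grind)
      have := Finset.le_card_sdiff {x, y} S
      rw [Finset.card_pair hxy.ne] at this
      lia
    obtain ⟨a, ha, x, hx, hva, hax, hxv⟩ := (h.of_le hc (by lia)).exists_adj_adj (by lia) hv
    have h₁ := key ha hx hax hva.ne' hxv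
    have h₂ : ((S \ {a, x}).filter (G.Adj v)).card < (S.filter (G.Adj v)).card :=
      Finset.card_lt_card (by
        rw [Finset.ssubset_iff_of_subset (by grind)]
        exact ⟨a, by grind, by grind⟩)
    obtain ⟨p, q, r, hp, hq, hr, hpq, hpr, hqr⟩ :=
      Finset.two_lt_card_iff.1 (by lia : 2 < (S.filter (G.Adj v)).card)
    obtain ⟨y, hy, z, hz, hyz⟩ :
        ∃ y ∈ S.filter (G.Adj v), ∃ z ∈ S.filter (G.Adj v), G.Adj y z := by
      by_contra hno
      push Not at hno
      exact hclaw v p q r (Finset.mem_filter.1 hp).2 (Finset.mem_filter.1 hq).2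
        (Finset.mem_filter.1 hr).2 hpq hpr hqr (hno p hp q hq)
        (hno p hp r hr) (hno q hq r hr)
    have h₃ := key (x := y) (y := z) (by grind) (by grind) hyz
      (G.ne_of_adj (Finset.mem_filter.1 hy).2).symm
      (G.ne_of_adj (Finset.mem_filter.1 hz).2).symm
    have h₄ : (S \ {y, z}).filter (G.Adj v) = S.filter (G.Adj v) \ {y, z} := by
      ext w
      simp only [Finset.mem_filter, Finset.mem_sdiff]
      tauto
    have hyzN : {y, z} ⊆ S.filter (G.Adj v) :=
      Finset.insert_subset hy (Finset.singleton_subset_iff.2 hz)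
    rw [h₄, Finset.card_sdiff_of_subset hyzN, Finset.card_pair hyz.ne] at h₃
    lia

end ExtOn

section Subgraph

variable {V : Type*} [DecidableEq V] {G : SimpleGraph V}

lemma Matchable.exists_isMatching [Finite V] {S : Finset V} (h : Matchable G S) :
    ∃ M : G.Subgraph, M.IsMatching ∧ M.verts = S ∧ 2 * M.edgeSet.ncard = S.card := by
  induction h with
  | empty => exact ⟨⊥, by simp [Subgraph.IsMatching], by simp, by simp⟩
  | @insert_pair x y S h hx hy _ ih =>
    obtain ⟨M, hM, hMS, hMc⟩ := ih
    refine ⟨G.subgraphOfAdj h ⊔ M, ?_, ?_, ?_⟩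
    · refine (Subgraph.IsMatching.subgraphOfAdj h).sup hM ?_
      rw [hM.support_eq_verts, (Subgraph.IsMatching.subgraphOfAdj h).support_eq_verts, hMS,
        Set.disjoint_left]
      simp [hx, hy]
    · ext z
      simp [hMS, or_assoc]
    · have hnot : s(x, y) ∉ M.edgeSet := fun hxy ↦ hx (by
        have := M.edge_vert (Subgraph.mem_edgeSet.1 hxy)
        rwa [hMS] at this)
      rw [Subgraph.edgeSet_sup, edgeSet_subgraphOfAdj, Set.singleton_union,
        Set.ncard_insert_of_notMem hnot, Finset.card_insert_of_notMem (by simp [h.ne, hx]),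
        Finset.card_insert_of_notMem hy]
      lia

lemma SimpleGraph.Subgraph.IsMatching.matchable {P : G.Subgraph} (hP : P.IsMatching)
    (U : Finset V) (hU : (U : Set V) ⊆ P.verts) (hcl : ∀ u ∈ U, ∀ w, P.Adj u w → w ∈ U) :
    Matchable G U := by
  induction hn : U.card using Nat.strong_induction_on generalizing U with
  | _ n ih =>
    obtain rfl | ⟨u, hu⟩ := U.eq_empty_or_nonempty
    · exact .empty
    obtain ⟨w, huw, huniq⟩ := hP (hU hu)
    have hw := hcl u hu w huw
    refine .of_sdiff_pair huw.adj_sub hu hw (ih _ ?_ _ ?_ ?_ rfl)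
    · exact hn ▸ card_sdiff_lt_of_mem hu (by simp)
    · exact fun z hz ↦ hU (by simp at hz ⊢; exact hz.1)
    · intro z hz t hzt
      have ht := hcl z (by grind) t hzt
      have htu : t ≠ u := by
        rintro rfl
        have := huniq z hzt.symm
        grind
      have htw : t ≠ w := by
        rintro rfl
        have := hP.eq_of_adj_right hzt huw
        grind
      grind

lemma KExt.extOn_univ [Fintype V] {k : ℕ} (h : KExt G k) : ExtOn G Finset.univ k := by
  obtain ⟨hconn, ⟨P, hP⟩, hext⟩ := h
  refine ⟨fun A _ hA hB ↦ ?_, fun T _ hT hTc ↦ ?_, ?_⟩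
  · obtain ⟨a, ha⟩ := hA
    obtain ⟨b, hb⟩ := hB
    obtain ⟨w⟩ := hconn.preconnected a b
    obtain ⟨d, -, hd₁, hd₂⟩ := w.exists_boundary_dart (A : Set V) ha (by simpa using hb)
    exact ⟨d.fst, hd₁, d.snd, by simpa using hd₂, d.adj⟩
  · obtain ⟨M, hM, hMT, hMc⟩ := hT.exists_isMatching
    obtain ⟨P, hP, hMP⟩ := hext M hM (by lia)
    refine hP.1.matchable _ (fun z _ ↦ hP.2 z) fun u hu w huw ↦ ?_
    by_contra hw
    have hwM : w ∈ M.verts := by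
      rw [hMT]
      simpa using hw
    obtain ⟨z, hwz, -⟩ := hM hwM
    have hzu : z = u := hP.1.eq_of_adj_left (hMP.2 hwz) huw.symm
    have huM := M.edge_vert hwz.symm
    rw [hMT, hzu] at huM
    simp at hu
    exact hu huM
  · exact hP.1.matchable _ (fun z _ ↦ hP.2 z) (by simp)

end Subgraph

theorem stmt5 {V : Type*} [Fintype V] (G : SimpleGraph V) [DecidableRel G.Adj] (n k : ℕ)
    (hn : Fintype.card V = 2 * n) (hk : 1 ≤ k) (hkn : k ≤ n - 1)
    (hclaw : ClawFree G) (hG : KExt G k) :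
    2 * k ≤ G.minDegree := by
  classical
  have : Nonempty V := hG.1.nonempty
  refine G.le_minDegree_of_forall_le_degree _ fun v ↦ ?_
  have := hG.extOn_univ.two_mul_le_card_neighbors hclaw hk
    (by rw [Finset.card_univ]; lia) (Finset.mem_univ v)
  rw [← G.card_neighborFinset_eq_degree, G.neighborFinset_eq_filter]
  convert this
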